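/- Let a ∈ (0,1) and ã ∈ (0,1], and suppose f is nondecreasing on (−∞,0] and nonincreasing on [0,∞). Define h(x) = (F⁻¹(x) − a·F⁻¹(ã x))/(1 − a) (an increasing bijection of ℝ). Then for every ν ≥ 0 one has F(ν) ≥ ã·h⁻¹(ν), and for every ν ≤ 0 one has F(ν) ≤ ã·h⁻¹(ν). -/

import Mathlib

open MeasureTheory Filter

/-- `F(y) = ∫_0^y f(x) dx`. -/
noncomputable def Fint (f : ℝ → ℝ) (y : ℝ) : ℝ := ∫ x in (0:ℝ)..y, f x

/-- `h(x) = (F⁻¹(x) − a·F⁻¹(ã x))/(1 − a)`, where `Finv` plays the role of `F⁻¹`. -/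
noncomputable def hFun (Finv : ℝ → ℝ) (a atil x : ℝ) : ℝ :=
  (Finv x - a * Finv (atil * x)) / (1 - a)

theorem strictMono_Fint {f : ℝ → ℝ} (hf : Continuous f) (hfpos : ∀ x, 0 < f x) :
    StrictMono (Fint f) := by
  intro x y hxy
  have hadd := intervalIntegral.integral_add_adjacent_intervals
    (hf.intervalIntegrable 0 x (μ := volume)) (hf.intervalIntegrable x y)
  have hpos := intervalIntegral.intervalIntegral_pos_of_pos
    (hf.intervalIntegrable x y) hfpos hxy
  unfold Fint
  linarith

/-- The extrapolation of `u` away from `v` lies on the same side of `v` as `u`. -/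
theorem le_extrapolation {a u v : ℝ} (ha : a < 1) (huv : v ≤ u) :
    v ≤ (u - a * v) / (1 - a) := by
  rw [le_div_iff₀ (by linarith)]
  linarith

theorem extrapolation_le {a u v : ℝ} (ha : a < 1) (huv : u ≤ v) :
    (u - a * v) / (1 - a) ≤ v := by
  rw [div_le_iff₀ (by linarith)]
  linarith

theorem stmt11 (f Finv : ℝ → ℝ)
    (hf : Continuous f) (hfpos : ∀ x, 0 < f x)
    (hFbot : Tendsto (Fint f) atBot atBot) (hFtop : Tendsto (Fint f) atTop atTop)
    (hFinv1 : ∀ y, Fint f (Finv y) = y) (hFinv2 : ∀ y, Finv (Fint f y) = y)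
    (hfmono : MonotoneOn f (Set.Iic 0)) (hfanti : AntitoneOn f (Set.Ici 0))
    (a atil : ℝ) (ha : a ∈ Set.Ioo (0:ℝ) 1) (hatil : atil ∈ Set.Ioc (0:ℝ) 1) :
    (∀ ν, 0 ≤ ν → ∀ z, hFun Finv a atil z = ν → atil * z ≤ Fint f ν) ∧
    (∀ ν, ν ≤ 0 → ∀ z, hFun Finv a atil z = ν → Fint f ν ≤ atil * z) := by
  have hF := strictMono_Fint hf hfpos
  have h0 : Fint f 0 = 0 := by simp [Fint]
  obtain ⟨-, ha1⟩ := ha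
  obtain ⟨ht0, ht1⟩ := hatil
  have hmono : Monotone Finv := fun x y hxy => by
    rwa [← hF.le_iff_le, hFinv1, hFinv1]
  have hle : ∀ z, 0 ≤ z → Finv (atil * z) ≤ hFun Finv a atil z := fun z hz =>
    le_extrapolation ha1 (hmono (mul_le_of_le_one_left hz ht1))
  have hge : ∀ z, z ≤ 0 → hFun Finv a atil z ≤ Finv (atil * z) := fun z hz =>
    extrapolation_le ha1 (hmono (by nlinarith))
  constructor
  · rintro ν hν z rfl
    rcases le_or_gt 0 z with hz | hz
    · simpa only [hFinv1] using hF.monotone (hle z hz)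
    · have h := hF.monotone (hν.trans (hge z hz.le))
      rw [h0, hFinv1] at h
      nlinarith
  · rintro ν hν z rfl
    rcases le_or_gt z 0 with hz | hz
    · simpa only [hFinv1] using hF.monotone (hge z hz)
    · have h := hF.monotone ((hle z hz.le).trans hν)
      rw [h0, hFinv1] at h
      nlinarith
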